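/- Let K be a unital commutative ring and q ∈ K with [N]_q = 0 and [n]_q invertible in K for all 1 ≤ n ≤ N−1 (N ≥ 2). Let C₀ and C₁ be N-complexes of K-modules with N-differentials d₀, d₁, and define d on the graded tensor product C₀ ⊗ C₁ by d(x₀ ⊗ x₁) = d₀(x₀) ⊗ x₁ + qⁿ · x₀ ⊗ d₁(x₁) for x₀ ∈ C₀ⁿ, x₁ ∈ C₁. Then d^N = 0, i.e. C₀ ⊗ C₁ equipped with d is again an N-complex. Moreover d^N(x₀ ⊗ x₁) = d₀^N(x₀) ⊗ x₁ + x₀ ⊗ d₁^N(x₁) holds before imposing d₀^N = 0 = d₁^N. -/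

import Mathlib

open TensorProduct

/-- The `q`-integer `[n]_q = 1 + q + … + q^{n-1}`, with `[0]_q = 0`. -/
def qInt {K : Type*} [CommRing K] (q : K) (n : ℕ) : K :=
  ∑ k ∈ Finset.range n, q ^ k

/-- The Gaussian binomial coefficient `[i + j choose i]_q`, indexed by `i` and `j`. -/
def gaussBinom {K : Type*} [CommRing K] (q : K) : ℕ → ℕ → K
  | 0, _ => 1
  | _ + 1, 0 => 1
  | i + 1, j + 1 => gaussBinom q i (j + 1) + q ^ (i + 1) * gaussBinom q (i + 1) j

section GaussBinom

variable {K : Type*} [CommRing K] (q : K)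

@[simp]
theorem gaussBinom_zero_left (j : ℕ) : gaussBinom q 0 j = 1 := by
  simp [gaussBinom]

@[simp]
theorem gaussBinom_zero_right (i : ℕ) : gaussBinom q i 0 = 1 := by
  cases i <;> simp [gaussBinom]

theorem gaussBinom_succ_succ (i j : ℕ) :
    gaussBinom q (i + 1) (j + 1) =
      gaussBinom q i (j + 1) + q ^ (i + 1) * gaussBinom q (i + 1) j := by
  rw [gaussBinom]

theorem qInt_add (i j : ℕ) : qInt q (i + j) = qInt q i + q ^ i * qInt q j := by
  simp only [qInt, Finset.sum_range_add, Finset.mul_sum, pow_add]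

theorem pow_eq_one_of_qInt_eq_zero {q : K} {N : ℕ} (h : qInt q N = 0) : q ^ N = 1 := by
  have := geom_sum_mul q N
  rw [qInt] at h
  rw [h, zero_mul] at this
  exact (sub_eq_zero.mp this.symm)

/-- The `q`-factorial `[m]_q! = [1]_q [2]_q ⋯ [m]_q`. -/
def qFactorial (m : ℕ) : K :=
  ∏ k ∈ Finset.range m, qInt q (k + 1)

theorem qFactorial_succ (m : ℕ) : qFactorial q (m + 1) = qFactorial q m * qInt q (m + 1) :=
  Finset.prod_range_succ _ _

theorem gaussBinom_mul_qFactorial (i j : ℕ) :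
    gaussBinom q i j * (qFactorial q i * qFactorial q j) = qFactorial q (i + j) := by
  induction i generalizing j with
  | zero => simp [qFactorial]
  | succ i ihi =>
    induction j with
    | zero => simp [qFactorial]
    | succ j ihj =>
      have h₁ := ihi (j + 1)
      rw [← add_assoc] at h₁
      have h₂ : i + 1 + j = i + j + 1 := by ring
      have h₃ : i + 1 + (j + 1) = i + j + 1 + 1 := by ring
      rw [h₂] at ihj
      have h₄ : qInt q (i + j + 1 + 1) = qInt q (i + 1) + q ^ (i + 1) * qInt q (j + 1) := by
        rw [← h₃, qInt_add]
      rw [h₃, qFactorial_succ q (i + j + 1), h₄, gaussBinom_succ_succ]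
      rw [qFactorial_succ q i] at ihj ⊢
      rw [qFactorial_succ q j] at h₁ ⊢
      linear_combination qInt q (i + 1) * h₁ + q ^ (i + 1) * qInt q (j + 1) * ihj

theorem isUnit_qFactorial {N m : ℕ} (hinv : ∀ n : ℕ, 1 ≤ n → n ≤ N - 1 → IsUnit (qInt q n))
    (hm : m < N) : IsUnit (qFactorial q m) := by
  induction m with
  | zero => simp [qFactorial]
  | succ m ih =>
    rw [qFactorial_succ]
    exact (ih (by omega)).mul (hinv _ (by omega) (by omega))

theorem gaussBinom_eq_zero {N i j : ℕ} (hN : qInt q N = 0)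
    (hinv : ∀ n : ℕ, 1 ≤ n → n ≤ N - 1 → IsUnit (qInt q n))
    (hij : i + j = N) (hi : i ≠ 0) (hj : j ≠ 0) : gaussBinom q i j = 0 := by
  have h := gaussBinom_mul_qFactorial q i j
  obtain ⟨M, rfl⟩ : ∃ M, N = M + 1 := ⟨N - 1, by omega⟩
  rw [hij, qFactorial_succ, hN, mul_zero] at h
  exact ((isUnit_qFactorial q hinv (by omega : i < M + 1)).mul
    (isUnit_qFactorial q hinv (by omega : j < M + 1))).mul_left_eq_zero.mp h

open Finset in
theorem sum_antidiagonal_succ_gaussBinom_smul {M : Type*} [AddCommGroup M] [Module K M]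
    (T : ℕ → ℕ → M) (m : ℕ) :
    ∑ p ∈ antidiagonal (m + 1), gaussBinom q p.1 p.2 • T p.1 p.2 =
      ∑ p ∈ antidiagonal m,
        gaussBinom q p.1 p.2 • (T (p.1 + 1) p.2 + q ^ p.1 • T p.1 (p.2 + 1)) := by
  let L : ℕ × ℕ → M := fun p => p.1.casesOn 0 fun i => gaussBinom q i p.2 • T (i + 1) p.2
  let R : ℕ × ℕ → M := fun p =>
    p.2.casesOn 0 fun j => gaussBinom q p.1 j • q ^ p.1 • T p.1 (j + 1)
  have hL : ∑ p ∈ antidiagonal (m + 1), L p =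
      ∑ p ∈ antidiagonal m, gaussBinom q p.1 p.2 • T (p.1 + 1) p.2 := by
    rw [Nat.sum_antidiagonal_succ]
    simp [L]
  have hR : ∑ p ∈ antidiagonal (m + 1), R p =
      ∑ p ∈ antidiagonal m, gaussBinom q p.1 p.2 • q ^ p.1 • T p.1 (p.2 + 1) := by
    rw [Nat.sum_antidiagonal_succ']
    simp [R]
  simp only [smul_add, sum_add_distrib]
  rw [← hL, ← hR, ← sum_add_distrib]
  refine sum_congr rfl ?_
  rintro ⟨i, j⟩ hij
  rw [HasAntidiagonal.mem_antidiagonal] at hij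
  rcases i with _ | i <;> rcases j with _ | j
  · simp at hij
  · simp [L, R]
  · simp [L, R]
  · simp [L, R, gaussBinom_succ_succ, add_smul, smul_smul, mul_comm]

open Finset in
/-- The `q`-binomial formula for an operator acting on a doubly indexed family. -/
theorem pow_apply_eq_sum_gaussBinom {M : Type*} [AddCommGroup M] [Module K M]
    (D : Module.End K M) (T : ℕ → ℕ → M)
    (hT : ∀ i j, D (T i j) = T (i + 1) j + q ^ i • T i (j + 1)) (m : ℕ) :
    (D ^ m) (T 0 0) = ∑ p ∈ antidiagonal m, gaussBinom q p.1 p.2 • T p.1 p.2 := by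
  induction m with
  | zero => simp
  | succ m ih =>
    rw [pow_succ', Module.End.mul_apply, ih, map_sum, sum_antidiagonal_succ_gaussBinom_smul]
    simp only [map_smul, hT]

open Finset in
theorem pow_apply_eq_add_of_qInt_eq_zero {M : Type*} [AddCommGroup M] [Module K M] {N : ℕ}
    (hN₀ : N ≠ 0) (hN : qInt q N = 0)
    (hinv : ∀ n : ℕ, 1 ≤ n → n ≤ N - 1 → IsUnit (qInt q n))
    (D : Module.End K M) (T : ℕ → ℕ → M)
    (hT : ∀ i j, D (T i j) = T (i + 1) j + q ^ i • T i (j + 1)) :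
    (D ^ N) (T 0 0) = T N 0 + T 0 N := by
  rw [pow_apply_eq_sum_gaussBinom q D T hT, sum_eq_add (N, 0) (0, N)]
  · simp
  · simp [hN₀]
  · rintro ⟨i, j⟩ hij ⟨h₁, h₂⟩
    rw [HasAntidiagonal.mem_antidiagonal] at hij
    simp only at hij
    rw [gaussBinom_eq_zero q hN hinv hij, zero_smul]
    · rintro rfl
      simp_all
    · rintro rfl
      simp_all
  · simp
  · simp

end GaussBinom

theorem pow_apply_mem_of_degree_one {K C : Type*} [CommRing K] [AddCommGroup C] [Module K C]
    {𝒜 : ℤ → Submodule K C} {d : Module.End K C}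
    (hd : ∀ (n : ℤ), ∀ x ∈ 𝒜 n, d x ∈ 𝒜 (n + 1)) {n : ℤ} {x : C} (hx : x ∈ 𝒜 n) (i : ℕ) :
    (d ^ i) x ∈ 𝒜 (n + i) := by
  induction i with
  | zero => simpa using hx
  | succ i ih =>
    rw [pow_succ', Module.End.mul_apply]
    have := hd _ _ ih
    rwa [add_assoc, ← Nat.cast_succ] at this

/-- Under assumption (A) (`[N]_q = 0` and `[n]_q` invertible for `1 ≤ n ≤ N-1`),
let `C₀`, `C₁` be `N`-complexes of `K`-modules and `D` the endomorphism of
`C₀ ⊗ C₁` determined by `D (x₀ ⊗ x₁) = d₀ x₀ ⊗ x₁ + qⁿ • x₀ ⊗ d₁ x₁` for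
`x₀` of degree `n`.  Then, before imposing `d₀^N = 0 = d₁^N`, one has
`D^N (x₀ ⊗ x₁) = d₀^N x₀ ⊗ x₁ + x₀ ⊗ d₁^N x₁`; and if `d₀^N = 0` and
`d₁^N = 0` then `D^N = 0`, i.e. `C₀ ⊗ C₁` is again an `N`-complex. -/
theorem tensor_product_N_complex {K : Type*} [CommRing K] (q : Kˣ)
    (N : ℕ) (hN : 2 ≤ N) (hNq : qInt (q : K) N = 0)
    (hinv : ∀ n : ℕ, 1 ≤ n → n ≤ N - 1 → IsUnit (qInt (q : K) n))
    {C₀ C₁ : Type*} [AddCommGroup C₀] [Module K C₀]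
    [AddCommGroup C₁] [Module K C₁]
    (𝒜₀ : ℤ → Submodule K C₀) (𝒜₁ : ℤ → Submodule K C₁)
    (hA₀ : DirectSum.IsInternal 𝒜₀) (hA₁ : DirectSum.IsInternal 𝒜₁)
    (d₀ : Module.End K C₀) (d₁ : Module.End K C₁)
    (hd₀ : ∀ (n : ℤ), ∀ x ∈ 𝒜₀ n, d₀ x ∈ 𝒜₀ (n + 1))
    (hd₁ : ∀ (n : ℤ), ∀ x ∈ 𝒜₁ n, d₁ x ∈ 𝒜₁ (n + 1))
    (D : Module.End K (C₀ ⊗[K] C₁))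
    (hD : ∀ (n : ℤ), ∀ x₀ ∈ 𝒜₀ n, ∀ x₁ : C₁,
      D (x₀ ⊗ₜ[K] x₁) =
        (d₀ x₀) ⊗ₜ[K] x₁ + ((q ^ n : Kˣ) : K) • (x₀ ⊗ₜ[K] (d₁ x₁))) :
    (∀ (n : ℤ), ∀ x₀ ∈ 𝒜₀ n, ∀ x₁ : C₁,
      (D ^ N) (x₀ ⊗ₜ[K] x₁) =
        ((d₀ ^ N) x₀) ⊗ₜ[K] x₁ + x₀ ⊗ₜ[K] ((d₁ ^ N) x₁)) ∧
    (d₀ ^ N = 0 → d₁ ^ N = 0 → D ^ N = 0) := by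
  have key : ∀ (n : ℤ), ∀ x₀ ∈ 𝒜₀ n, ∀ x₁ : C₁,
      (D ^ N) (x₀ ⊗ₜ[K] x₁) =
        ((d₀ ^ N) x₀) ⊗ₜ[K] x₁ + x₀ ⊗ₜ[K] ((d₁ ^ N) x₁) := by
    intro n x₀ hx₀ x₁
    have hpow : ((q ^ n : Kˣ) : K) ^ N = 1 := by
      have hq : q ^ N = 1 := by
        ext
        simpa using pow_eq_one_of_qInt_eq_zero hNq
      rw [← Units.val_pow_eq_pow_val, ← zpow_natCast, zpow_comm, zpow_natCast, hq, one_zpow,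
        Units.val_one]
    have h := pow_apply_eq_add_of_qInt_eq_zero (q : K) (by omega : N ≠ 0) hNq hinv D
      (fun i j => ((q ^ n : Kˣ) : K) ^ j • ((d₀ ^ i) x₀ ⊗ₜ[K] (d₁ ^ j) x₁)) fun i j => by
        rw [map_smul, hD _ _ (pow_apply_mem_of_degree_one hd₀ hx₀ i), zpow_add, zpow_natCast]
        simp only [pow_succ' d₀, pow_succ' d₁, Module.End.mul_apply, smul_add, smul_smul,
          Units.val_mul, Units.val_pow_eq_pow_val]
        congr 2
        ring
    simpa [hpow] using h
  refine ⟨key, fun h₀ h₁ => TensorProduct.ext' fun x₀ x₁ => ?_⟩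
  have hx₀ : x₀ ∈ ⨆ n, 𝒜₀ n := hA₀.submodule_iSup_eq_top ▸ Submodule.mem_top
  induction hx₀ using Submodule.iSup_induction' with
  | mem n x hx => simp [key n x hx x₁, h₀, h₁]
  | zero => simp
  | add x y _ _ hx hy => rw [TensorProduct.add_tmul, map_add, hx, hy, map_add]
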